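/- Let P be a finite partial IP loop. Then #Γ(P) ≡ (#P − 1)(#P − 2) − o₃(P) (mod 6). -/

import Mathlib

/-- A partial IP loop: a set `carrier` with a partial binary operation defined on
a domain `dom ⊆ carrier ×ˢ carrier` (the value of `mul` is only meaningful on `dom`),
with a unit, unique two-sided inverses, and the inverse property. -/
structure PartialIPLoop (α : Type*) where
  carrier : Set α
  one : α
  dom : Set (α × α)
  mul : α → α → α
  inv : α → α
  one_mem : one ∈ carrier
  dom_subset : dom ⊆ carrier ×ˢ carrier
  mul_mem : ∀ x y, (x, y) ∈ dom → mul x y ∈ carrier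
  one_mul_dom : ∀ x ∈ carrier, (one, x) ∈ dom
  mul_one_dom : ∀ x ∈ carrier, (x, one) ∈ dom
  one_mul : ∀ x ∈ carrier, mul one x = x
  mul_one : ∀ x ∈ carrier, mul x one = x
  inv_mem : ∀ x ∈ carrier, inv x ∈ carrier
  mul_inv_dom : ∀ x ∈ carrier, (x, inv x) ∈ dom
  inv_mul_dom : ∀ x ∈ carrier, (inv x, x) ∈ dom
  mul_inv : ∀ x ∈ carrier, mul x (inv x) = one
  inv_mul : ∀ x ∈ carrier, mul (inv x) x = one
  inv_unique : ∀ x ∈ carrier, ∀ y ∈ carrier,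
    (x, y) ∈ dom → (y, x) ∈ dom → mul x y = one → mul y x = one → y = inv x
  ip_left_dom : ∀ x y, (x, y) ∈ dom → (inv x, mul x y) ∈ dom
  ip_right_dom : ∀ x y, (x, y) ∈ dom → (mul x y, inv y) ∈ dom
  ip_left : ∀ x y, (x, y) ∈ dom → mul (inv x) (mul x y) = y
  ip_right : ∀ x y, (x, y) ∈ dom → mul (mul x y) (inv y) = x

namespace PartialIPLoop

variable {α : Type*}

/-- The set of gaps `Γ(P) = (P × P) \ D(P)`. -/
def gaps (P : PartialIPLoop α) : Set (α × α) :=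
  (P.carrier ×ˢ P.carrier) \ P.dom

/-- The set `O₂(P)` of elements of order two. -/
def O2 (P : PartialIPLoop α) : Set α :=
  {x ∈ P.carrier | x ≠ P.one ∧ (x, x) ∈ P.dom ∧ P.mul x x = P.one}

/-- The set `O₃(P)` of elements of order three. -/
def O3 (P : PartialIPLoop α) : Set α :=
  {x ∈ P.carrier | x ≠ P.one ∧ (x, x) ∈ P.dom ∧ (x, P.mul x x) ∈ P.dom ∧
    P.mul x (P.mul x x) = P.one}

/-- `Q` is an extension of `P`: `P ⊆ Q`, `D(P) ⊆ D(Q)`, and the operations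
agree on `D(P)`. -/
def Ext (P Q : PartialIPLoop α) : Prop :=
  P.carrier ⊆ Q.carrier ∧ P.dom ⊆ Q.dom ∧
    ∀ x y, (x, y) ∈ P.dom → P.mul x y = Q.mul x y

end PartialIPLoop

namespace Set

/-- A self-map of prime period `p` of a finite set has as many fixed points, modulo `p`, as the
set has elements. -/
theorem ncard_modEq_ncard_fixed {β : Type*} {S : Set β} (hS : S.Finite) (f : β → β)
    (p : ℕ) [hp : Fact p.Prime] (hf : ∀ x ∈ S, f x ∈ S) (hfp : ∀ x ∈ S, f^[p] x = x) :
    S.ncard ≡ {x ∈ S | f x = x}.ncard [MOD p] := by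
  classical
  have := hS.fintype
  let g : Function.End S := MapsTo.restrict f S S hf
  have hg : g ^ p ^ 1 = 1 := by
    rw [pow_one]
    funext x
    apply Subtype.ext
    have h (n : ℕ) : ∀ y : S, ((g ^ n) y : β) = f^[n] y := by
      induction n with
      | zero => exact fun _ => rfl
      | succ n ih => exact fun y => ih (g y)
    exact (h p x).trans (hfp x x.2)
  have h := Equiv.Perm.card_fixedPoints_modEq hg
  rw [← Nat.card_eq_fintype_card, ← Nat.card_eq_fintype_card, Nat.card_coe_set_eq,
    Nat.card_coe_set_eq] at h
  convert h using 1
  rw [← ncard_image_of_injective _ Subtype.val_injective]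
  congr 1
  ext x
  constructor
  · rintro ⟨hx, hfx⟩
    exact ⟨⟨x, hx⟩, Subtype.ext hfx, rfl⟩
  · rintro ⟨y, hy, rfl⟩
    exact ⟨y.2, congrArg Subtype.val hy⟩

end Set

namespace PartialIPLoop

variable {α : Type*} (P : PartialIPLoop α) {x y : α}

theorem inv_inv (hx : x ∈ P.carrier) : P.inv (P.inv x) = x :=
  (P.inv_unique _ (P.inv_mem x hx) x hx (P.inv_mul_dom x hx) (P.mul_inv_dom x hx)
    (P.inv_mul x hx) (P.mul_inv x hx)).symm

theorem inv_one : P.inv P.one = P.one := by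
  rw [← P.one_mul _ (P.inv_mem _ P.one_mem), P.mul_inv _ P.one_mem]

theorem inv_ne_one (hx : x ∈ P.carrier) (h : x ≠ P.one) : P.inv x ≠ P.one := fun h' =>
  h (by rw [← P.inv_inv hx, h', P.inv_one])

theorem left_mem (h : (x, y) ∈ P.dom) : x ∈ P.carrier := (P.dom_subset h).1

theorem right_mem (h : (x, y) ∈ P.dom) : y ∈ P.carrier := (P.dom_subset h).2

theorem eq_inv_of_mul_eq_one (h : (x, y) ∈ P.dom) (h1 : P.mul x y = P.one) : y = P.inv x := by
  rw [← P.ip_left x y h, h1, P.mul_one _ (P.inv_mem x (P.left_mem h))]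

theorem rotate_dom (h : (x, y) ∈ P.dom) : (y, P.inv (P.mul x y)) ∈ P.dom := by
  have := P.ip_right_dom _ _ (P.ip_left_dom _ _ h)
  rwa [P.ip_left _ _ h] at this

theorem rotate_mul (h : (x, y) ∈ P.dom) : P.mul y (P.inv (P.mul x y)) = P.inv x := by
  have := P.ip_right _ _ (P.ip_left_dom _ _ h)
  rwa [P.ip_left _ _ h] at this

theorem reverse_dom (h : (x, y) ∈ P.dom) : (P.inv y, P.inv x) ∈ P.dom := by
  have := P.rotate_dom (P.ip_right_dom _ _ h)
  rwa [P.ip_right _ _ h] at this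

theorem reverse_mul (h : (x, y) ∈ P.dom) :
    P.mul (P.inv y) (P.inv x) = P.inv (P.mul x y) := by
  have := P.rotate_mul (P.ip_right_dom _ _ h)
  rwa [P.ip_right _ _ h] at this

/-- The pairs in the domain that are not forced to be there by the unit and inverse axioms. -/
def nontrivialDom : Set (α × α) :=
  {p ∈ P.dom | p.1 ≠ P.one ∧ p.2 ≠ P.one ∧ P.mul p.1 p.2 ≠ P.one}

theorem dom_finite (hP : P.carrier.Finite) : P.dom.Finite :=
  (hP.prod hP).subset P.dom_subset

theorem nontrivialDom_finite (hP : P.carrier.Finite) : P.nontrivialDom.Finite :=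
  (P.dom_finite hP).subset fun _ h => h.1

theorem mul_self_of_mem_O3 (h : x ∈ P.O3) : P.mul x x = P.inv x :=
  P.eq_inv_of_mul_eq_one h.2.2.2.1 h.2.2.2.2

theorem inv_ne_self_of_mem_O3 (h : x ∈ P.O3) : P.inv x ≠ x := by
  intro h'
  have h1 := P.mul_inv x h.1
  rw [h', P.mul_self_of_mem_O3 h, h'] at h1
  exact h.2.1 h1

theorem inv_mem_O3 (h : x ∈ P.O3) : P.inv x ∈ P.O3 := by
  have hm : P.mul (P.inv x) (P.inv x) = x := by
    rw [P.reverse_mul h.2.2.1, P.mul_self_of_mem_O3 h, P.inv_inv h.1]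
  refine ⟨P.inv_mem x h.1, P.inv_ne_one h.1 h.2.1, P.reverse_dom h.2.2.1, ?_, ?_⟩
  · rw [hm]
    exact P.inv_mul_dom x h.1
  · rw [hm, P.inv_mul x h.1]

theorem ncard_O3_modEq_zero (hP : P.carrier.Finite) : P.O3.ncard ≡ 0 [MOD 2] := by
  have h := Set.ncard_modEq_ncard_fixed (hP.subset fun _ h => h.1 : P.O3.Finite) P.inv 2
    (fun _ hx => P.inv_mem_O3 hx) (fun x hx => P.inv_inv hx.1)
  have he : {x ∈ P.O3 | P.inv x = x} = ∅ :=
    Set.eq_empty_of_forall_notMem fun x hx => P.inv_ne_self_of_mem_O3 hx.1 hx.2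
  rwa [he, Set.ncard_empty] at h

theorem ncard_nontrivialDom_modEq_zero (hP : P.carrier.Finite) :
    P.nontrivialDom.ncard ≡ 0 [MOD 2] := by
  have h := Set.ncard_modEq_ncard_fixed (P.nontrivialDom_finite hP)
    (fun p => (P.inv p.2, P.inv p.1)) 2 ?_ ?_
  · have he : {p ∈ P.nontrivialDom | (P.inv p.2, P.inv p.1) = p} = ∅ := by
      refine Set.eq_empty_of_forall_notMem ?_
      rintro ⟨x, y⟩ ⟨⟨hd, -, -, hm⟩, hf⟩
      have hy : P.inv x = y := (Prod.mk.inj hf).2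
      subst hy
      exact hm (P.mul_inv x (P.left_mem hd))
    rwa [he, Set.ncard_empty] at h
  · rintro ⟨x, y⟩ ⟨hd, hx, hy, hm⟩
    refine ⟨P.reverse_dom hd, P.inv_ne_one (P.right_mem hd) hy,
      P.inv_ne_one (P.left_mem hd) hx, ?_⟩
    rw [P.reverse_mul hd]
    exact P.inv_ne_one (P.mul_mem _ _ hd) hm
  · rintro ⟨x, y⟩ ⟨hd, -⟩
    exact Prod.ext (P.inv_inv (P.left_mem hd)) (P.inv_inv (P.right_mem hd))

theorem ncard_nontrivialDom_modEq_O3 (hP : P.carrier.Finite) :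
    P.nontrivialDom.ncard ≡ P.O3.ncard [MOD 3] := by
  have h := Set.ncard_modEq_ncard_fixed (P.nontrivialDom_finite hP)
    (fun p => (p.2, P.inv (P.mul p.1 p.2))) 3 ?_ ?_
  · have he : {p ∈ P.nontrivialDom | (p.2, P.inv (P.mul p.1 p.2)) = p} =
        (fun x => (x, x)) '' P.O3 := by
      ext ⟨x, y⟩
      constructor
      · rintro ⟨⟨hd, hx, -, -⟩, hf⟩
        have hyx : y = x := (Prod.mk.inj hf).1
        subst hyx
        have hi : P.inv (P.mul y y) = y := (Prod.mk.inj hf).2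
        have hm : P.mul y y = P.inv y := by
          rw [← P.inv_inv (P.mul_mem _ _ hd), hi]
        have hc := P.left_mem hd
        refine ⟨y, ⟨hc, hx, hd, ?_, ?_⟩, rfl⟩
        · rw [hm]
          exact P.mul_inv_dom y hc
        · rw [hm, P.mul_inv y hc]
      · rintro ⟨z, hz, hzxy⟩
        obtain ⟨rfl, rfl⟩ := Prod.mk.inj hzxy
        have hm := P.mul_self_of_mem_O3 hz
        refine ⟨⟨hz.2.2.1, hz.2.1, hz.2.1, ?_⟩, ?_⟩
        · rw [hm]
          exact P.inv_ne_one hz.1 hz.2.1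
        · simp only [hm, P.inv_inv hz.1]
    rwa [he, Set.ncard_image_of_injective _ fun a b hab => (Prod.mk.inj hab).1] at h
  · rintro ⟨x, y⟩ ⟨hd, hx, hy, hm⟩
    refine ⟨P.rotate_dom hd, hy, P.inv_ne_one (P.mul_mem _ _ hd) hm, ?_⟩
    rw [P.rotate_mul hd]
    exact P.inv_ne_one (P.left_mem hd) hx
  · rintro ⟨x, y⟩ ⟨hd, -⟩
    have h2 := P.rotate_mul (P.rotate_dom hd)
    simp only [Function.iterate_succ, Function.iterate_zero, Function.comp_apply, id_eq,
      P.rotate_mul hd, P.inv_inv (P.left_mem hd)] at h2 ⊢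
    rw [h2, P.inv_inv (P.right_mem hd)]

theorem ncard_dom_diff_nontrivialDom (hP : P.carrier.Finite) :
    (P.dom \ P.nontrivialDom).ncard + 2 = 3 * P.carrier.ncard := by
  set C := P.carrier \ {P.one} with hC
  have hCfin : C.Finite := hP.sdiff
  have hcard : C.ncard + 1 = P.carrier.ncard := Set.ncard_sdiff_singleton_add_one P.one_mem hP
  have he : P.dom \ P.nontrivialDom =
      (fun x => (P.one, x)) '' P.carrier ∪
        ((fun x => (x, P.one)) '' C ∪ (fun x => (x, P.inv x)) '' C) := by
    ext ⟨x, y⟩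
    constructor
    · rintro ⟨hd, hn⟩
      have hx := P.left_mem hd
      by_cases h1 : x = P.one
      · exact Or.inl ⟨y, P.right_mem hd, by rw [h1]⟩
      · by_cases h2 : y = P.one
        · exact Or.inr (Or.inl ⟨x, ⟨hx, h1⟩, by rw [h2]⟩)
        · by_cases h3 : P.mul x y = P.one
          · exact Or.inr (Or.inr ⟨x, ⟨hx, h1⟩, by rw [P.eq_inv_of_mul_eq_one hd h3]⟩)
          · exact absurd ⟨hd, h1, h2, h3⟩ hn
    · rintro (⟨z, hz, hxy⟩ | ⟨z, hz, hxy⟩ | ⟨z, hz, hxy⟩) <;>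
        obtain ⟨rfl, rfl⟩ := Prod.mk.inj hxy
      · exact ⟨P.one_mul_dom _ hz, fun h => h.2.1 rfl⟩
      · exact ⟨P.mul_one_dom _ hz.1, fun h => h.2.2.1 rfl⟩
      · exact ⟨P.mul_inv_dom _ hz.1, fun h => h.2.2.2 (P.mul_inv _ hz.1)⟩
  have hdisj : Disjoint ((fun x => (x, P.one)) '' C) ((fun x => (x, P.inv x)) '' C) := by
    rw [Set.disjoint_left]
    rintro _ ⟨a, ha, rfl⟩ ⟨b, hb, hab⟩
    exact P.inv_ne_one hb.1 hb.2 (Prod.mk.inj hab).2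
  have hdisj' : Disjoint ((fun x => (P.one, x)) '' P.carrier)
      ((fun x => (x, P.one)) '' C ∪ (fun x => (x, P.inv x)) '' C) := by
    rw [Set.disjoint_left]
    rintro _ ⟨a, ha, rfl⟩ (⟨b, hb, hab⟩ | ⟨b, hb, hab⟩) <;> exact hb.2 (Prod.mk.inj hab).1
  rw [he, Set.ncard_union_eq hdisj' (hP.image _) ((hCfin.image _).union (hCfin.image _)),
    Set.ncard_union_eq hdisj (hCfin.image _) (hCfin.image _),
    Set.ncard_image_of_injective _ fun a b hab => (Prod.mk.inj hab).2,
    Set.ncard_image_of_injective _ fun a b hab => (Prod.mk.inj hab).1,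
    Set.ncard_image_of_injective _ fun a b hab => (Prod.mk.inj hab).1]
  omega

theorem ncard_gaps_add_ncard_nontrivialDom (hP : P.carrier.Finite) :
    (P.gaps.ncard : ℤ) + P.nontrivialDom.ncard =
      ((P.carrier.ncard : ℤ) - 1) * ((P.carrier.ncard : ℤ) - 2) := by
  have h1 : P.gaps.ncard + P.dom.ncard = (P.carrier ×ˢ P.carrier).ncard :=
    Set.ncard_sdiff_add_ncard_of_subset P.dom_subset (hP.prod hP)
  have h2 : (P.dom \ P.nontrivialDom).ncard + P.nontrivialDom.ncard = P.dom.ncard :=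
    Set.ncard_sdiff_add_ncard_of_subset (fun _ h => h.1) (P.dom_finite hP)
  have h3 := P.ncard_dom_diff_nontrivialDom hP
  rw [Set.ncard_prod] at h1
  zify at h1 h2 h3
  linear_combination h1 + h2 - h3

end PartialIPLoop

/-- Lemma 2: for a finite partial IP loop `P`,
`#Γ(P) ≡ (#P − 1)(#P − 2) − o₃(P) (mod 6)`. -/
theorem gaps_card_modeq {α : Type*} (P : PartialIPLoop α) (hP : P.carrier.Finite) :
    (P.gaps.ncard : ℤ) ≡
      ((P.carrier.ncard : ℤ) - 1) * ((P.carrier.ncard : ℤ) - 2) -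
        (P.O3.ncard : ℤ) [ZMOD 6] := by
  have h1 := P.ncard_gaps_add_ncard_nontrivialDom hP
  have h2 := P.ncard_nontrivialDom_modEq_zero hP
  have h3 := P.ncard_O3_modEq_zero hP
  have h4 := P.ncard_nontrivialDom_modEq_O3 hP
  rw [← h1]
  simp only [Nat.ModEq, Int.ModEq] at *
  omega
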